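/- arXiv:2305.08813 — 2 statements merged into one kernel-verified Lean document; each statement's English description precedes it below -/
import Mathlib

section
/- Let p be a positive integer, let w be a random vector distributed according to the standard Gaussian measure on ℝ^p, and let v_1, v_2 ∈ ℝ^p be nonzero vectors with angle θ = arccos(⟨v_1, v_2⟩/(‖v_1‖‖v_2‖)). Then E[ σ(⟨w, v_1⟩) · σ(⟨w, v_2⟩) ] = (‖v_1‖‖v_2‖ / (2π)) · ( (π − θ) cos θ + sin θ ), where σ(z) = max{0, z} is the ReLU function. -/
open MeasureTheory ProbabilityTheory

/-- The standard Gaussian measure on `ℝ^p`: the `p`-fold product of `N(0,1)`. -/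
noncomputable def stdGaussian (p : ℕ) : Measure (Fin p → ℝ) :=
  Measure.pi fun _ => gaussianReal 0 1

lemma charFunDual_map_pair_pi_gaussianReal {ι : Type*} [Fintype ι] (a b : ι → ℝ)
    (L : StrongDual ℝ (ℝ × ℝ)) :
    charFunDual ((Measure.pi fun _ : ι => gaussianReal 0 1).map
        (fun w => (∑ i, w i * a i, ∑ i, w i * b i))) L =
      Complex.exp (-((L (1, 0) ^ 2 * ∑ i, a i ^ 2 + 2 * (L (1, 0) * L (0, 1)) * ∑ i, a i * b i +
        L (0, 1) ^ 2 * ∑ i, b i ^ 2 : ℝ) : ℂ) / 2) := by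
  rw [charFunDual_apply, integral_map (by fun_prop)
    (Continuous.aestronglyMeasurable (by fun_prop))]
  have hL : ∀ s t : ℝ, L (s, t) = s * L (1, 0) + t * L (0, 1) := by
    intro s t
    have : ((s, t) : ℝ × ℝ) = s • (1, 0) + t • (0, 1) := by simp
    rw [this, map_add, map_smul, map_smul, smul_eq_mul, smul_eq_mul]
  have hprod : ∀ w : ι → ℝ,
      Complex.exp (L (∑ i, w i * a i, ∑ i, w i * b i) * Complex.I) =
      ∏ i, Complex.exp (((a i * L (1, 0) + b i * L (0, 1) : ℝ) : ℂ) * (w i) * Complex.I) := by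
    intro w
    rw [hL, ← Complex.exp_sum, ← Finset.sum_mul, Finset.sum_mul, Finset.sum_mul,
      ← Finset.sum_add_distrib]
    push_cast
    congr 2
    exact Finset.sum_congr rfl fun i _ => by ring
  simp_rw [hprod]
  rw [integral_fintype_prod_eq_prod (f := fun i (t : ℝ) =>
    Complex.exp (((a i * L (1, 0) + b i * L (0, 1) : ℝ) : ℂ) * t * Complex.I))]
  simp_rw [← charFun_apply_real, charFun_gaussianReal]
  rw [← Complex.exp_sum]
  congr 1
  simp only [Finset.mul_sum, ← Finset.sum_add_distrib]
  push_cast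
  rw [← Finset.sum_neg_distrib, Finset.sum_div]
  exact Finset.sum_congr rfl fun i _ => by ring

/-- The law of a pair of linear functionals of a standard Gaussian vector depends only on their
Gram matrix. -/
lemma map_pair_pi_gaussianReal_eq {ι κ : Type*} [Fintype ι] [Fintype κ]
    {x y : ι → ℝ} {x' y' : κ → ℝ} (hxx : ∑ i, x i ^ 2 = ∑ j, x' j ^ 2)
    (hxy : ∑ i, x i * y i = ∑ j, x' j * y' j) (hyy : ∑ i, y i ^ 2 = ∑ j, y' j ^ 2) :
    (Measure.pi fun _ : ι => gaussianReal 0 1).map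
        (fun w => (∑ i, w i * x i, ∑ i, w i * y i)) =
      (Measure.pi fun _ : κ => gaussianReal 0 1).map
        (fun w => (∑ j, w j * x' j, ∑ j, w j * y' j)) := by
  refine Measure.ext_of_charFunDual ?_
  ext L
  simp only [charFunDual_map_pair_pi_gaussianReal, hxx, hxy, hyy]

open Real in
lemma integral_max_cos_mul_max_cos_sub {θ : ℝ} (h0 : 0 ≤ θ) (hπ : θ ≤ π) :
    ∫ φ in Set.Ioo (-π) π, max 0 (cos φ) * max 0 (cos (φ - θ)) =
      ((π - θ) * cos θ + sin θ) / 2 := by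
  have hint : ∀ a b : ℝ, IntervalIntegrable
      (fun φ => max 0 (cos φ) * max 0 (cos (φ - θ))) volume a b := fun a b =>
    Continuous.intervalIntegrable (by fun_prop) a b
  rw [← integral_Ioc_eq_integral_Ioo,
    ← intervalIntegral.integral_of_le (by linarith [pi_pos]),
    ← intervalIntegral.integral_add_adjacent_intervals (hint (-π) (θ - π / 2)) (hint _ π),
    ← intervalIntegral.integral_add_adjacent_intervals (hint (θ - π / 2) (π / 2)) (hint _ π)]
  have hleft : ∫ φ in (-π)..(θ - π / 2), max 0 (cos φ) * max 0 (cos (φ - θ)) = 0 := by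
    apply intervalIntegral.integral_zero_ae
    refine ae_of_all _ fun φ hφ => ?_
    rw [Set.uIoc_of_le (by linarith [pi_pos])] at hφ
    rcases le_total φ (-(π / 2)) with h | h
    · have : cos φ ≤ 0 := by
        rw [← cos_neg]
        exact cos_nonpos_of_pi_div_two_le_of_le (by linarith) (by linarith [hφ.1, pi_pos])
      rw [max_eq_left this, zero_mul]
    · have : cos (φ - θ) ≤ 0 := by
        rw [← cos_neg]
        exact cos_nonpos_of_pi_div_two_le_of_le (by linarith [hφ.2]) (by linarith [pi_pos])
      rw [max_eq_left this, mul_zero]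
  have hright : ∫ φ in (π / 2)..π, max 0 (cos φ) * max 0 (cos (φ - θ)) = 0 := by
    apply intervalIntegral.integral_zero_ae
    refine ae_of_all _ fun φ hφ => ?_
    rw [Set.uIoc_of_le (by linarith [pi_pos])] at hφ
    have : cos φ ≤ 0 :=
      cos_nonpos_of_pi_div_two_le_of_le hφ.1.le (by linarith [hφ.2, pi_pos])
    rw [max_eq_left this, zero_mul]
  have hmid : ∫ φ in (θ - π / 2)..(π / 2), max 0 (cos φ) * max 0 (cos (φ - θ)) =
      ∫ φ in (θ - π / 2)..(π / 2), (cos θ / 2 + cos (2 * φ - θ) / 2) := by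
    refine intervalIntegral.integral_congr fun φ hφ => ?_
    rw [Set.uIcc_of_le (by linarith)] at hφ
    have h1 : 0 ≤ cos φ := cos_nonneg_of_neg_pi_div_two_le_of_le (by linarith [hφ.1]) hφ.2
    have h2 : 0 ≤ cos (φ - θ) :=
      cos_nonneg_of_neg_pi_div_two_le_of_le (by linarith [hφ.1]) (by linarith [hφ.2])
    have h3 : cos θ = cos φ * cos (φ - θ) + sin φ * sin (φ - θ) := by
      rw [← cos_sub]; congr 1; ring
    have h4 : cos (2 * φ - θ) = cos φ * cos (φ - θ) - sin φ * sin (φ - θ) := by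
      rw [← cos_add]; congr 1; ring
    simp only [max_eq_right h1, max_eq_right h2]
    rw [h3, h4]; ring
  have hderiv : ∀ φ ∈ Set.uIcc (θ - π / 2) (π / 2), HasDerivAt
      (fun φ => cos θ / 2 * φ + sin (2 * φ - θ) / 4) (cos θ / 2 + cos (2 * φ - θ) / 2) φ := by
    intro φ _
    have hl : HasDerivAt (fun φ => 2 * φ - θ) 2 φ := by
      simpa using ((hasDerivAt_id φ).const_mul 2).sub_const θ
    convert! ((hasDerivAt_id φ).const_mul (cos θ / 2)).add (hl.sin.div_const 4) using 1
    ring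
  rw [hleft, hright, hmid, intervalIntegral.integral_eq_sub_of_hasDerivAt hderiv
    (Continuous.intervalIntegrable (by fun_prop) _ _)]
  have e1 : sin (2 * (π / 2) - θ) = sin θ := by rw [← sin_pi_sub θ]; congr 1; ring
  have e2 : sin (2 * (θ - π / 2) - θ) = -sin θ := by rw [← sin_sub_pi θ]; congr 1; ring
  rw [e1, e2]
  ring

open Real in
lemma integral_cube_mul_exp_neg_sq_div_two :
    ∫ r in Set.Ioi (0 : ℝ), r ^ 3 * exp (-r ^ 2 / 2) = 2 := by
  have h := integral_rpow_mul_exp_neg_mul_rpow (p := 2) (q := 3) (b := 1 / 2)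
    (by norm_num) (by norm_num) (by norm_num)
  have hG : Gamma ((3 + 1) / 2) = 1 := by norm_num
  have hb : ((1 : ℝ) / 2) ^ (-(3 + 1) / 2 : ℝ) = 4 := by
    rw [show (-(3 + 1) / 2 : ℝ) = ((-2 : ℤ) : ℝ) by norm_num, rpow_intCast]
    norm_num
  rw [hG, hb] at h
  calc _ = ∫ r in Set.Ioi (0 : ℝ), r ^ (3 : ℝ) * exp (-(1 / 2) * r ^ (2 : ℝ)) := by
        refine integral_congr_ae (ae_of_all _ fun r => ?_)
        norm_cast
        simp only
        congr 2
        ring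
    _ = 2 := by rw [h]; norm_num

open Real in
/-- Integration against the standard Gaussian measure of the plane, in polar coordinates. -/
lemma integral_gaussianReal_prod_eq_polar (f : ℝ × ℝ → ℝ) :
    ∫ z, f z ∂((gaussianReal 0 1).prod (gaussianReal 0 1)) =
      ∫ q in Set.Ioi (0 : ℝ) ×ˢ Set.Ioo (-π) π,
        q.1 * ((2 * π)⁻¹ * exp (-q.1 ^ 2 / 2) * f (q.1 * cos q.2, q.1 * sin q.2)) := by
  rw [gaussianReal_of_var_ne_zero _ one_ne_zero,
    prod_withDensity (measurable_gaussianPDF 0 1) (measurable_gaussianPDF 0 1),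
    integral_withDensity_eq_integral_toReal_smul (by fun_prop)
      (ae_of_all _ fun z => ENNReal.mul_lt_top gaussianPDF_lt_top gaussianPDF_lt_top),
    ← Measure.volume_eq_prod, ← integral_comp_polarCoord_symm]
  refine integral_congr_ae (ae_of_all _ fun q => ?_)
  have hexp : exp (-(q.1 * cos q.2) ^ 2 / 2) * exp (-(q.1 * sin q.2) ^ 2 / 2) =
      exp (-q.1 ^ 2 / 2) := by
    rw [← exp_add]
    congr 1
    linear_combination (-q.1 ^ 2 / 2) * sin_sq_add_cos_sq q.2
  have hsqrt : (√(2 * π))⁻¹ * (√(2 * π))⁻¹ = (2 * π)⁻¹ := by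
    rw [← mul_inv, mul_self_sqrt (by positivity)]
  simp only [polarCoord_symm_apply, ENNReal.toReal_mul, toReal_gaussianPDF, gaussianPDFReal,
    smul_eq_mul, NNReal.coe_one, mul_one, sub_zero]
  rw [← hexp, ← hsqrt]
  ring

open Real in
lemma integral_relu_mul_relu_gaussianReal_prod {θ : ℝ} (h0 : 0 ≤ θ) (hπ : θ ≤ π) :
    ∫ z : ℝ × ℝ, max 0 z.1 * max 0 (z.1 * cos θ + z.2 * sin θ)
        ∂((gaussianReal 0 1).prod (gaussianReal 0 1)) =
      (2 * π)⁻¹ * ((π - θ) * cos θ + sin θ) := by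
  rw [integral_gaussianReal_prod_eq_polar]
  have hsep : Set.EqOn
      (fun q : ℝ × ℝ => q.1 * ((2 * π)⁻¹ * exp (-q.1 ^ 2 / 2) *
        (max 0 (q.1 * cos q.2) * max 0 (q.1 * cos q.2 * cos θ + q.1 * sin q.2 * sin θ))))
      (fun q => ((2 * π)⁻¹ * (q.1 ^ 3 * exp (-q.1 ^ 2 / 2))) *
        (max 0 (cos q.2) * max 0 (cos (q.2 - θ))))
      (Set.Ioi (0 : ℝ) ×ˢ Set.Ioo (-π) π) := by
    rintro ⟨r, φ⟩ ⟨hr, -⟩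
    have hr : 0 ≤ r := le_of_lt hr
    have hmax : ∀ c : ℝ, max 0 (r * c) = r * max 0 c := fun c => by
      rw [mul_max_of_nonneg _ _ hr, mul_zero]
    have hcos : r * cos φ * cos θ + r * sin φ * sin θ = r * cos (φ - θ) := by
      rw [cos_sub]; ring
    simp only [hcos, hmax]
    ring
  rw [setIntegral_congr_fun (measurableSet_Ioi.prod measurableSet_Ioo) hsep,
    Measure.volume_eq_prod, setIntegral_prod_mul
      (fun r : ℝ => (2 * π)⁻¹ * (r ^ 3 * exp (-r ^ 2 / 2)))
      (fun φ : ℝ => max 0 (cos φ) * max 0 (cos (φ - θ))),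
    integral_const_mul, integral_cube_mul_exp_neg_sq_div_two,
    integral_max_cos_mul_max_cos_sub h0 hπ]
  ring

/-- the Gaussian expectation at the core of Lemma C.2 of the paper, the
first-order arc-cosine kernel. Let `w` be a standard Gaussian vector in `ℝ^p` and let
`v₁, v₂ ∈ ℝ^p` be nonzero with angle `θ = arccos(⟨v₁,v₂⟩/(‖v₁‖‖v₂‖))`. With
`σ(z) = max 0 z` the ReLU function,
`E[σ(⟨w, v₁⟩) σ(⟨w, v₂⟩)] = (‖v₁‖‖v₂‖/(2π)) ((π − θ) cos θ + sin θ)`. -/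
theorem gaussian_relu_expectation
    (p : ℕ) (hp : 0 < p) (v₁ v₂ : Fin p → ℝ) (hv₁ : v₁ ≠ 0) (hv₂ : v₂ ≠ 0)
    (θ : ℝ)
    (hθ : θ = Real.arccos ((∑ k, v₁ k * v₂ k) /
      (Real.sqrt (∑ k, (v₁ k) ^ 2) * Real.sqrt (∑ k, (v₂ k) ^ 2)))) :
    (∫ w, max 0 (∑ k, w k * v₁ k) * max 0 (∑ k, w k * v₂ k) ∂(stdGaussian p)) =
      Real.sqrt (∑ k, (v₁ k) ^ 2) * Real.sqrt (∑ k, (v₂ k) ^ 2) / (2 * Real.pi) *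
        ((Real.pi - θ) * Real.cos θ + Real.sin θ) := by
  set a := Real.sqrt (∑ k, (v₁ k) ^ 2) with ha
  set b := Real.sqrt (∑ k, (v₂ k) ^ 2) with hb
  have hpos : ∀ v : Fin p → ℝ, v ≠ 0 → 0 < ∑ k, v k ^ 2 := by
    intro v hv
    obtain ⟨k, hk⟩ := Function.ne_iff.mp hv
    exact Finset.sum_pos' (fun i _ => sq_nonneg _) ⟨k, Finset.mem_univ k, sq_pos_of_ne_zero hk⟩
  have ha0 : 0 < a := Real.sqrt_pos.mpr (hpos v₁ hv₁)
  have hb0 : 0 < b := Real.sqrt_pos.mpr (hpos v₂ hv₂)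
  have ha2 : a ^ 2 = ∑ k, v₁ k ^ 2 := Real.sq_sqrt (hpos v₁ hv₁).le
  have hb2 : b ^ 2 = ∑ k, v₂ k ^ 2 := Real.sq_sqrt (hpos v₂ hv₂).le
  have habs : |∑ k, v₁ k * v₂ k| ≤ a * b := by
    refine abs_le_of_sq_le_sq ?_ (by positivity)
    rw [mul_pow, ha2, hb2]
    exact Finset.sum_mul_sq_le_sq_mul_sq _ _ _
  have hcos : a * b * Real.cos θ = ∑ k, v₁ k * v₂ k := by
    rw [hθ, Real.cos_arccos, mul_div_cancel₀ _ (by positivity)]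
    · rw [le_div_iff₀ (by positivity)]
      linarith [neg_le_of_abs_le habs]
    · rw [div_le_one (by positivity)]
      exact le_of_abs_le habs
  have hlaw := map_pair_pi_gaussianReal_eq (x := v₁) (y := v₂) (x' := ![a, 0])
    (y' := ![b * Real.cos θ, b * Real.sin θ])
    (by simp [ha2]) (by simp [← hcos]; ring)
    (by simp only [Fin.sum_univ_two, Matrix.cons_val_zero, Matrix.cons_val_one]
        linear_combination (-b ^ 2) * Real.sin_sq_add_cos_sq θ - hb2)
  have hmax : ∀ {c : ℝ}, 0 < c → ∀ t, max 0 (c * t) = c * max 0 t := fun hc t => by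
    rw [mul_max_of_nonneg _ _ hc.le, mul_zero]
  calc ∫ w, max 0 (∑ k, w k * v₁ k) * max 0 (∑ k, w k * v₂ k) ∂(stdGaussian p)
      = ∫ z : ℝ × ℝ, max 0 z.1 * max 0 z.2 ∂((Measure.pi fun _ : Fin p => gaussianReal 0 1).map
          (fun w => (∑ i, w i * v₁ i, ∑ i, w i * v₂ i))) := by
        rw [integral_map (by fun_prop) (by fun_prop)]
        rfl
    _ = ∫ w : Fin 2 → ℝ, a * b *
          (max 0 (w 0) * max 0 (w 0 * Real.cos θ + w 1 * Real.sin θ))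
          ∂(Measure.pi fun _ : Fin 2 => gaussianReal 0 1) := by
        rw [hlaw, integral_map (by fun_prop) (by fun_prop)]
        refine integral_congr_ae (ae_of_all _ fun w => ?_)
        have e1 : ∑ j, w j * ![a, 0] j = a * w 0 := by simp; ring
        have e2 : ∑ j, w j * ![b * Real.cos θ, b * Real.sin θ] j =
            b * (w 0 * Real.cos θ + w 1 * Real.sin θ) := by simp; ring
        simp only [e1, e2, hmax ha0, hmax hb0]
        ring
    _ = a * b * ∫ z : ℝ × ℝ, max 0 z.1 * max 0 (z.1 * Real.cos θ + z.2 * Real.sin θ)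
          ∂((gaussianReal 0 1).prod (gaussianReal 0 1)) := by
        rw [integral_const_mul, ← (measurePreserving_finTwoArrow (gaussianReal 0 1)).integral_comp
          MeasurableEquiv.finTwoArrow.measurableEmbedding]
        rfl
    _ = a * b / (2 * Real.pi) * ((Real.pi - θ) * Real.cos θ + Real.sin θ) := by
        rw [integral_relu_mul_relu_gaussianReal_prod (hθ ▸ Real.arccos_nonneg _)
          (hθ ▸ Real.arccos_le_pi _)]
        ring
end

section
/- Define g : [0, π) → [0, π) by g(z) = arccos( ((π − z) cos z + sin z)/π ), and let g^l denote the l-fold composition of g (g^0 = identity). Then for every fixed natural number l, as z → 0 from the right, g^l(z) = z − (l/(3π)) z² + o(z²); that is, z ↦ g^l(z) − (z − (l/(3π)) z²) is o(z²) as z → 0⁺. -/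
open Asymptotics

/-- The layer-to-layer embedding-angle map of an infinitely wide ReLU network:
`g z = arccos(((π − z) cos z + sin z)/π)`. -/
noncomputable def g (z : ℝ) : ℝ :=
  Real.arccos (((Real.pi - z) * Real.cos z + Real.sin z) / Real.pi)

open Filter Topology in
theorem cos_sub_taylor_isBigO :
    (fun x : ℝ => Real.cos x - (1 - x ^ 2 / 2)) =O[𝓝 0] fun x : ℝ => x ^ 4 := by
  refine IsBigO.of_bound (5 / 96) ?_
  filter_upwards [Metric.ball_mem_nhds (0 : ℝ) one_pos] with x hx
  have hx' : |x| ≤ 1 := by simpa [Real.dist_eq] using (Metric.mem_ball.1 hx).le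
  simpa [mul_comm] using Real.cos_bound hx'

open Filter Topology in
theorem sin_sub_taylor_isBigO :
    (fun x : ℝ => Real.sin x - (x - x ^ 3 / 6)) =O[𝓝 0] fun x : ℝ => x ^ 5 := by
  refine IsBigO.of_bound (1 / 100) ?_
  filter_upwards [Metric.ball_mem_nhds (0 : ℝ) one_pos] with x hx
  have hx' : |x| ≤ 1 := by simpa [Real.dist_eq] using (Metric.mem_ball.1 hx).le
  simpa [mul_comm, div_eq_mul_inv] using Real.sin_bound hx'

open Filter Topology in
/-- The cosine of `z - a z²` exceeds `cos (g z)` by `(a - 1/(3π)) z³ + o(z³)`. -/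
theorem cos_sub_sq_sub_cos_g_isLittleO (a : ℝ) :
    (fun z : ℝ => Real.cos (z - a * z ^ 2)
        - ((Real.pi - z) * Real.cos z + Real.sin z) / Real.pi
        - (a - 1 / (3 * Real.pi)) * z ^ 3) =o[𝓝 0] fun z : ℝ => z ^ 3 := by
  have pow_four : (fun z : ℝ => z ^ 4) =o[𝓝 0] fun z : ℝ => z ^ 3 :=
    isLittleO_pow_pow (by norm_num)
  have bounded {f : ℝ → ℝ} (hf : Continuous f) : f =O[𝓝 0] fun _ => (1 : ℝ) :=
    hf.continuousAt.isBigO_one ℝ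
  have tendsto_zero : Tendsto (fun z : ℝ => z - a * z ^ 2) (𝓝 0) (𝓝 0) := by
    have : Continuous fun z : ℝ => z - a * z ^ 2 := by fun_prop
    simpa using this.tendsto 0
  have shifted : (fun z : ℝ => (z - a * z ^ 2) ^ 4) =O[𝓝 0] fun z : ℝ => z ^ 4 := by
    have := (bounded (f := fun z => (1 - a * z) ^ 4) (by fun_prop)).mul
      (isBigO_refl (fun z : ℝ => z ^ 4) (𝓝 0))
    refine (this.congr (fun z => ?_) (fun z => ?_)) <;> ring
  have cos_shifted := (cos_sub_taylor_isBigO.comp_tendsto tendsto_zero).trans shifted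
  have cos_term := (bounded (f := fun z => (Real.pi - z) / Real.pi) (by fun_prop)).mul
    cos_sub_taylor_isBigO
  have sin_term := (sin_sub_taylor_isBigO.trans
    (isLittleO_pow_pow (by norm_num : 4 < 5)).isBigO).const_mul_left (1 / Real.pi)
  have quartic : (fun z : ℝ => a ^ 2 / 2 * z ^ 4) =O[𝓝 0] fun z : ℝ => z ^ 4 :=
    (isBigO_refl _ _).const_mul_left _
  simp only [one_mul] at cos_term
  refine ((((cos_shifted.sub cos_term).sub sin_term).sub quartic).congr_left
    fun z => ?_).trans_isLittleO pow_four
  simp only [Function.comp_apply]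
  field_simp
  ring

open Filter Topology in
theorem g_asymptotic_expansion :
    (fun z : ℝ => g z - (z - 1 / (3 * Real.pi) * z ^ 2)) =o[𝓝[>] 0] fun z : ℝ => z ^ 2 := by
  rw [isLittleO_iff]
  intro ε hε
  have mem_Icc (a : ℝ) : ∀ᶠ z in 𝓝[>] (0 : ℝ), z - a * z ^ 2 ∈ Set.Icc 0 Real.pi := by
    have small : ∀ᶠ z in 𝓝 (0 : ℝ), a * z < 1 :=
      ((continuous_const.mul continuous_id).tendsto' 0 0 (by simp)).eventually_lt_const one_pos
    have below : ∀ᶠ z in 𝓝 (0 : ℝ), z - a * z ^ 2 < Real.pi :=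
      ((by fun_prop : Continuous fun z : ℝ => z - a * z ^ 2).tendsto' 0 0
        (by simp)).eventually_lt_const Real.pi_pos
    filter_upwards [small.filter_mono nhdsWithin_le_nhds,
      below.filter_mono nhdsWithin_le_nhds, self_mem_nhdsWithin] with z h1 h2 hz
    have hz : 0 < z := hz
    exact ⟨by nlinarith, h2.le⟩
  have remainder (a : ℝ) :=
    ((cos_sub_sq_sub_cos_g_isLittleO a).bound hε).filter_mono
      (nhdsWithin_le_nhds (s := Set.Ioi 0))
  filter_upwards [mem_Icc (1 / (3 * Real.pi) + ε), mem_Icc (1 / (3 * Real.pi) - ε),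
    remainder (1 / (3 * Real.pi) + ε), remainder (1 / (3 * Real.pi) - ε),
    self_mem_nhdsWithin] with z hlo hhi rlo rhi hz
  have hz3 : 0 < z ^ 3 := pow_pos hz 3
  rw [Real.norm_eq_abs, Real.norm_of_nonneg hz3.le, abs_le] at rlo rhi
  have lower := Real.arccos_le_arccos (show ((Real.pi - z) * Real.cos z + Real.sin z) / Real.pi ≤
      Real.cos (z - (1 / (3 * Real.pi) + ε) * z ^ 2) by
    linarith [rlo.1])
  have upper := Real.arccos_le_arccos (show Real.cos (z - (1 / (3 * Real.pi) - ε) * z ^ 2) ≤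
      ((Real.pi - z) * Real.cos z + Real.sin z) / Real.pi by
    linarith [rhi.2])
  rw [Real.arccos_cos hlo.1 hlo.2] at lower
  rw [Real.arccos_cos hhi.1 hhi.2] at upper
  rw [Real.norm_eq_abs, Real.norm_of_nonneg (sq_nonneg z), abs_le, g]
  constructor <;> linarith

open Filter Topology in
theorem g_sub_id_isLittleO : (fun z : ℝ => g z - z) =o[𝓝[>] 0] fun z : ℝ => z := by
  have sq : (fun z : ℝ => z ^ 2) =o[𝓝[>] 0] fun z : ℝ => z :=
    (isLittleO_pow_id one_lt_two).mono nhdsWithin_le_nhds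
  refine ((g_asymptotic_expansion.trans sq).sub
    (sq.const_mul_left (1 / (3 * Real.pi)))).congr_left fun z => ?_
  ring

open Filter Topology in
theorem tendsto_g_nhdsGT_zero : Tendsto g (𝓝[>] 0) (𝓝[>] 0) := by
  refine tendsto_nhdsWithin_iff.2 ⟨?_, ?_⟩
  · have id_tendsto : Tendsto (fun z : ℝ => z) (𝓝[>] 0) (𝓝 0) := nhdsWithin_le_nhds
    simpa using (g_sub_id_isLittleO.trans_tendsto id_tendsto).add id_tendsto
  · filter_upwards [g_sub_id_isLittleO.bound one_half_pos, self_mem_nhdsWithin] with z h hz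
    have hz : 0 < z := hz
    rw [Real.norm_eq_abs, Real.norm_of_nonneg hz.le, abs_le] at h
    exact Set.mem_Ioi.2 (by linarith [h.1])

/-- Corollary 4.2 of the paper. For every fixed `l : ℕ`, as `z → 0⁺`,
the `l`-fold iterate satisfies `g^[l] z = z − (l/(3π)) z² + o(z²)`; i.e. the function
`z ↦ g^[l] z − (z − (l/(3π)) z²)` is `o(z²)` as `z → 0` from the right. -/
theorem iterate_g_asymptotic_expansion (l : ℕ) :
    (fun z : ℝ => g^[l] z - (z - (l : ℝ) / (3 * Real.pi) * z ^ 2))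
      =o[nhdsWithin 0 (Set.Ioi 0)] fun z : ℝ => z ^ 2 := by
  induction l with
  | zero => simp
  | succ l ih =>
    have g_isBigO : g =O[nhdsWithin 0 (Set.Ioi 0)] fun z : ℝ => z :=
      (g_sub_id_isLittleO.isBigO.add (isBigO_refl _ _)).congr_left fun z => by ring
    have outer := (ih.comp_tendsto tendsto_g_nhdsGT_zero).trans_isBigO (g_isBigO.pow 2)
    have sq_diff : (fun z : ℝ => g z ^ 2 - z ^ 2) =o[nhdsWithin 0 (Set.Ioi 0)]
        fun z : ℝ => z ^ 2 :=
      (g_sub_id_isLittleO.mul_isBigO (g_isBigO.add (isBigO_refl _ _))).congr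
        (fun z => by ring) (fun z => by ring)
    refine ((outer.add g_asymptotic_expansion).sub
      (sq_diff.const_mul_left ((l : ℝ) / (3 * Real.pi)))).congr_left fun z => ?_
    simp only [Function.comp_apply, Function.iterate_succ_apply, Nat.cast_succ]
    ring
end
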